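/- arXiv:2501.19229 — 2 statements merged into one kernel-verified Lean document; each statement's English description precedes it below -/
import Mathlib

section
/- The r-graph T_{r,1} is vertex-extendable with respect to the class of r-partite r-graphs: there exist ε > 0 and n₀ such that for every T_{r,1}-free r-graph H on n ≥ n₀ vertices with δ(H) ≥ n^{r−1}/r^{r−1} − ε n^{r−1}, if there is a vertex v with H − v r-partite, then H itself is r-partite. -/
/-- An `r`-graph `H` is `𝕋_{r,1}`-free if it contains no copy of the triangle
`𝕋_{r,1}`, whose edges are `{1,…,r}`, `{1} ∪ {r+1,…,2r−1}` and
`{2,…,r} ∪ {r+1}` (the case `i = 1` of `𝕋_{r,i}`). -/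
def Tr1Free (r : ℕ) {V : Type*} [DecidableEq V] (H : Finset (Finset V)) : Prop :=
  ¬ ∃ f : ℕ → V, Set.InjOn f (Set.Icc 1 (2 * r - 1)) ∧
      (Finset.Icc 1 r).image f ∈ H ∧
      ((insert 1 (Finset.Icc (r + 1) (2 * r - 1))).image f) ∈ H ∧
      ((insert (r + 1) (Finset.Icc 2 r)).image f) ∈ H

/-- An `r`-graph is `r`-partite if its vertices can be coloured with `r`
colours so that every edge contains exactly one vertex of each colour. -/
def RPartite (r : ℕ) {V : Type*} [DecidableEq V] [Fintype V]
    (H : Finset (Finset V)) : Prop :=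
  ∃ P : V → Fin r, ∀ e ∈ H, ∀ k : Fin r, (e.filter (fun u => P u = k)).card = 1

open Finset in
lemma aux_analytic (r : ℕ) (hr : 2 ≤ r) (b : Fin r → ℝ) (hb : ∀ i, 0 ≤ b i)
    (hs : ∑ i, b i = r)
    (hp : ∀ i, 1 - 1 / (64 * (r : ℝ) ^ 2) ≤ ∏ j ∈ univ.erase i, b j) (i : Fin r) :
    ∏ j ∈ univ.erase i, b j ≤ 1 + 1 / (2 * (r : ℝ)) := by
  have hr' : (2 : ℝ) ≤ r := by exact_mod_cast hr
  have hr0 : (0 : ℝ) < r := by linarith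
  set η : ℝ := 1 / (64 * (r : ℝ) ^ 2) with hη
  have hηpos : 0 < η := by positivity
  have hη1 : η ≤ 1 := by
    rw [hη, div_le_one (by positivity)]; nlinarith
  have hprod : ∀ k, b k * ∏ j ∈ univ.erase k, b j = ∏ j, b j := fun k =>
    Finset.mul_prod_erase univ b (mem_univ k)
  have hbig : 1 - η ≤ ∏ j, b j := by
    have h1 : ∑ k, b k * (1 - η) ≤ ∑ k : Fin r, ∏ j, b j := by
      apply Finset.sum_le_sum
      intro k _
      rw [← hprod k]
      exact mul_le_mul_of_nonneg_left (hp k) (hb k)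
    rw [← Finset.sum_mul, hs] at h1
    simp at h1
    exact le_of_mul_le_mul_left h1 hr0
  set p := ∏ j ∈ univ.erase i, b j with hpdef
  have hpe : p ≤ Real.exp (1 - b i) := by
    have h1 : p ≤ ∏ j ∈ univ.erase i, Real.exp (b j - 1) := by
      apply Finset.prod_le_prod
      · intro j _; exact hb j
      · intro j _; have := Real.add_one_le_exp (b j - 1); linarith
    rw [← Real.exp_sum] at h1
    have h2 : ∑ j ∈ univ.erase i, (b j - 1) = 1 - b i := by
      have h3 := Finset.add_sum_erase univ (fun j => b j - 1) (mem_univ i)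
      simp only [Finset.sum_sub_distrib, hs] at h3
      simp at h3
      simp only [Finset.sum_sub_distrib]
      simp
      linarith
    rwa [h2] at h1
  have h1r : 0 < 1 / (2 * (r : ℝ)) := by positivity
  by_cases hs0 : 1 - b i ≤ 0
  · have := Real.exp_le_one_iff.mpr hs0
    linarith
  push Not at hs0
  set s := 1 - b i with hsdef
  have hs1 : s ≤ 1 := by have := hb i; linarith
  have hkey : 1 - η ≤ (1 - s) * Real.exp s := by
    have h1 := hprod i
    have : b i = 1 - s := by rw [hsdef]; ring
    rw [this] at h1
    rw [← h1] at hbig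
    exact hbig.trans (mul_le_mul_of_nonneg_left hpe (by linarith))
  have hF := Real.add_one_le_exp (-(s / 2))
  have hFs : Real.exp (-(s/2)) ^ 2 * Real.exp s = 1 := by
    rw [sq, ← Real.exp_add, ← Real.exp_add, ← Real.exp_zero]; congr 1; ring
  have hE := Real.exp_pos s
  have hsq : s ^ 2 ≤ 4 * η := by
    have h1 : (1 - η) * Real.exp (-(s/2)) ^ 2 ≤ 1 - s := by
      have : (1 - η) * Real.exp (-(s/2)) ^ 2 ≤
          ((1 - s) * Real.exp s) * Real.exp (-(s/2)) ^ 2 :=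
        mul_le_mul_of_nonneg_right hkey (by positivity)
      calc _ ≤ _ := this
        _ = (1 - s) * (Real.exp (-(s/2)) ^ 2 * Real.exp s) := by ring
        _ = _ := by rw [hFs, mul_one]
    have h2 : (1 - s / 2) ^ 2 ≤ Real.exp (-(s/2)) ^ 2 :=
      pow_le_pow_left₀ (by linarith) (by linarith) 2
    have h3 : (1 - η) * (1 - s / 2) ^ 2 ≤ 1 - s :=
      (mul_le_mul_of_nonneg_left h2 (by linarith)).trans h1
    have h4 : (1 - s / 2) ^ 2 ≤ 1 := by nlinarith
    nlinarith
  have hs4 : s ≤ 1 / (4 * r) := by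
    apply le_of_sq_le_sq _ (by positivity)
    refine hsq.trans (le_of_eq ?_)
    rw [hη]; field_simp; norm_num
  have hs8 : s ≤ 1 / 2 := by
    refine hs4.trans ?_
    rw [div_le_div_iff₀ (by positivity) (by norm_num)]; linarith
  have h5 : Real.exp s * (1 - s) ≤ 1 := by
    have h6 := Real.add_one_le_exp (-s)
    have h7 : Real.exp s * Real.exp (-s) = 1 := by rw [← Real.exp_add]; simp
    nlinarith
  have h8 : Real.exp s ≤ 1 + 2 * s := by nlinarith
  have h9 : 2 * (1 / (4 * (r : ℝ))) = 1 / (2 * r) := by field_simp; norm_num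
  linarith

open Finset in
lemma aux_triangle (r : ℕ) (hr : 2 ≤ r) {V : Type*} [DecidableEq V] (H : Finset (Finset V))
    (hfree : Tr1Free r H) (e S : Finset V) (x y : V) (he : e ∈ H) (hec : e.card = r)
    (hx : x ∈ e) (hy : y ∈ e) (hxy : x ≠ y) (hS : S.card = r - 1) (hd : Disjoint S e)
    (h1 : insert x S ∈ H) (h2 : insert y S ∈ H) : False := by
  have hcR : ((e.erase x).erase y).card = r - 2 := by
    rw [card_erase_of_mem (mem_erase.mpr ⟨hxy.symm, hy⟩), card_erase_of_mem hx, hec]; omega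
  have hg : ∃ g : ℕ → V, Set.BijOn g (Icc 2 r : Finset ℕ) (S : Finset V) := by
    have : Nonempty V := ⟨x⟩
    apply (Finset.finite_toSet _).exists_bijOn_of_encard_eq
    simp only [Set.encard_coe_eq_coe_finsetCard, Nat.card_Icc, hS]
    congr 1
  have hh : ∃ g : ℕ → V, Set.BijOn g (Icc (r+2) (2*r-1) : Finset ℕ)
      ((e.erase x).erase y : Finset V) := by
    have : Nonempty V := ⟨x⟩
    apply (Finset.finite_toSet _).exists_bijOn_of_encard_eq
    simp only [Set.encard_coe_eq_coe_finsetCard, Nat.card_Icc, hcR]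
    congr 1; omega
  obtain ⟨g, hg⟩ := hg
  obtain ⟨h, hh⟩ := hh
  have hgi : (Icc 2 r).image g = S := by
    apply Finset.coe_injective; rw [coe_image]; exact hg.image_eq
  have hhi : (Icc (r+2) (2*r-1)).image h = (e.erase x).erase y := by
    apply Finset.coe_injective; rw [coe_image]; exact hh.image_eq
  have hxS : x ∉ S := fun hc => (Finset.disjoint_left.mp hd hc hx)
  have hyS : y ∉ S := fun hc => (Finset.disjoint_left.mp hd hc hy)
  set f : ℕ → V := fun k => if k = 1 then x else if k ≤ r then g k else
    if k = r + 1 then y else h k with hf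
  have f1 : f 1 = x := by simp [hf]
  have fr : f (r+1) = y := by
    have : r ≠ 0 := by omega
    simp [hf, this]
  have fg : ∀ k ∈ Icc 2 r, f k = g k := by
    intro k hk; rw [mem_Icc] at hk
    have : k ≠ 1 := by omega
    simp [hf, this, hk.2]
  have fh : ∀ k ∈ Icc (r+2) (2*r-1), f k = h k := by
    intro k hk; rw [mem_Icc] at hk
    have a1 : k ≠ 1 := by omega
    have a2 : ¬ k ≤ r := by omega
    have a3 : k ≠ r + 1 := by omega
    simp [hf, a1, a2, a3]
  have figS : (Icc 2 r).image f = S := by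
    rw [← hgi]; exact image_congr fun k hk => fg k hk
  have fihR : (Icc (r+2) (2*r-1)).image f = (e.erase x).erase y := by
    rw [← hhi]; exact image_congr fun k hk => fh k hk
  have E1 : Icc 1 r = insert 1 (Icc 2 r) := by
    ext k; simp only [mem_Icc, mem_insert]; omega
  have E2 : Icc (r+1) (2*r-1) = insert (r+1) (Icc (r+2) (2*r-1)) := by
    ext k; simp only [mem_Icc, mem_insert]; omega
  have E3 : Icc 1 (2*r-1) = Icc 1 r ∪ Icc (r+1) (2*r-1) := by
    ext k; simp only [mem_Icc, mem_union]; omega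
  have eqe : insert x (insert y ((e.erase x).erase y)) = e := by
    rw [insert_erase (mem_erase.mpr ⟨hxy.symm, hy⟩), insert_erase hx]
  apply hfree
  refine ⟨f, ?_, ?_, ?_, ?_⟩
  · have : (Set.Icc 1 (2*r-1) : Set ℕ) = ((Icc 1 (2*r-1) : Finset ℕ) : Set ℕ) := by simp
    rw [this]
    apply Finset.injOn_of_card_image_eq
    have : (Icc 1 (2*r-1)).image f = S ∪ e := by
      rw [E3, image_union, E1, E2, image_insert, image_insert, figS, fihR, f1, fr]
      rw [← eqe]
      ext k; simp only [mem_union, mem_insert, mem_erase]; tauto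
    rw [this, card_union_of_disjoint hd, hS, hec, Nat.card_Icc]; omega
  · rw [E1, image_insert, figS, f1]; exact h1
  · rw [E2, image_insert, image_insert, fihR, f1, fr, eqe]; exact he
  · rw [image_insert, figS, fr]; exact h2

open Finset in
/-- (r-1)-sets that are transversal to all colours but `i`. -/
def TT (r n : ℕ) (P : Fin n → Fin r) (i : Fin r) : Finset (Finset (Fin n)) :=
  (powersetCard (r-1) univ).filter (fun S => (∀ x ∈ S, ∀ y ∈ S, P x = P y → x = y) ∧
    ∀ x ∈ S, P x ≠ i)

open Finset in
lemma aux_star (r n : ℕ) (hr : 2 ≤ r) (w : Fin n) :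
    ((powersetCard (r-1) (univ : Finset (Fin n))).filter (fun S => w ∈ S)).card
      ≤ n ^ (r-2) := by
  have h : ((powersetCard (r-1) (univ : Finset (Fin n))).filter (fun S => w ∈ S)).card
      ≤ (powersetCard (r-2) (univ : Finset (Fin n))).card := by
    apply card_le_card_of_injOn (fun S => S.erase w)
    · intro S hS
      simp only [coe_filter, mem_powersetCard, Set.mem_ofPred_eq] at hS
      simp only [mem_coe, mem_powersetCard]
      refine ⟨subset_univ _, ?_⟩
      rw [card_erase_of_mem hS.2, hS.1.2]; omega
    · intro S hS S' hS' heq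
      simp only [coe_filter, Set.mem_ofPred_eq] at hS hS'
      have heq' : S.erase w = S'.erase w := heq
      rw [← insert_erase hS.2, heq', insert_erase hS'.2]
  refine h.trans ?_
  rw [card_powersetCard, card_univ, Fintype.card_fin]
  exact Nat.choose_le_pow n (r-2)

open Finset in
lemma aux_card (r n : ℕ) (P : Fin n → Fin r) (i : Fin r) (v : Fin n) :
    (TT r n P i).card ≤ ∏ j ∈ univ.erase i, (univ.filter (fun u => P u = j)).card := by
  set F : Finset (Fin r → Fin n) :=
    Fintype.piFinset (fun j => if j = i then {v} else univ.filter (fun u => P u = j)) with hF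
  have hFc : F.card = ∏ j ∈ univ.erase i, (univ.filter (fun u => P u = j)).card := by
    rw [hF, Fintype.card_piFinset, ← mul_prod_erase univ _ (mem_univ i)]
    simp only [if_true, card_singleton, one_mul]
    apply prod_congr rfl
    intro j hj
    rw [if_neg (mem_erase.mp hj).1]
  rw [← hFc]
  have : TT r n P i ⊆ F.image (fun g => (univ.erase i).image g) := by
    intro S hS
    simp only [TT, mem_filter, mem_powersetCard] at hS
    obtain ⟨⟨_, hc⟩, hinj, hi⟩ := hS
    have himg : S.image P = univ.erase i := by
      apply eq_of_subset_of_card_le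
      · intro k hk
        obtain ⟨x, hx, rfl⟩ := mem_image.mp hk
        exact mem_erase.mpr ⟨hi x hx, mem_univ _⟩
      · rw [card_image_of_injOn (fun x hx y hy h => hinj x hx y hy h), hc,
          card_erase_of_mem (mem_univ _)]; simp
    have hex : ∀ j : Fin r, ∃ u, j ≠ i → u ∈ S ∧ P u = j := by
      intro j
      by_cases hj : j = i
      · exact ⟨v, fun h => absurd hj h⟩
      · have : j ∈ S.image P := by rw [himg]; simp [hj]
        obtain ⟨x, hx, hxj⟩ := mem_image.mp this
        exact ⟨x, fun _ => ⟨hx, hxj⟩⟩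
    choose g hg using hex
    refine mem_image.mpr ⟨fun j => if j = i then v else g j, ?_, ?_⟩
    · rw [hF, Fintype.mem_piFinset]
      intro j
      by_cases hj : j = i
      · simp [hj]
      · simp [hj, (hg j hj).2]
    · ext x
      simp only [mem_image, mem_erase, mem_univ, and_true]
      constructor
      · rintro ⟨j, hj, rfl⟩
        rw [if_neg hj]; exact (hg j hj).1
      · intro hx
        refine ⟨P x, hi x hx, ?_⟩
        rw [if_neg (hi x hx)]
        exact hinj _ (hg _ (hi x hx)).1 _ hx (hg _ (hi x hx)).2
  exact (card_le_card this).trans card_image_le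

/-- link of `u` inside `TT`. -/
def LL (r n : ℕ) (H : Finset (Finset (Fin n))) (P : Fin n → Fin r) (i : Fin r) (u : Fin n) :
    Finset (Finset (Fin n)) :=
  (TT r n P i).filter (fun S => insert u S ∈ H)

open Finset in
lemma aux_common (r n : ℕ) (hr : 2 ≤ r) (H : Finset (Finset (Fin n))) (P : Fin n → Fin r)
    (hfree : Tr1Free r H) (e : Finset (Fin n)) (i : Fin r) (x y : Fin n)
    (he : e ∈ H) (hec : e.card = r) (hx : x ∈ e) (hy : y ∈ e) (hxy : x ≠ y)
    (hcard : (TT r n P i).card + r * n ^ (r-2) <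
      (LL r n H P i x).card + (LL r n H P i y).card) : False := by
  set A := LL r n H P i x
  set B := LL r n H P i y
  have hU : (A ∪ B).card ≤ (TT r n P i).card :=
    card_le_card (union_subset (filter_subset _ _) (filter_subset _ _))
  have hI := card_union_add_card_inter A B
  have hmeet : (e.biUnion (fun w => (powersetCard (r-1) (univ : Finset (Fin n))).filter
      (fun S => w ∈ S))).card ≤ r * n ^ (r-2) := by
    rw [← hec]
    exact card_biUnion_le_card_mul _ _ _ (fun w _ => by rw [hec]; exact aux_star r n hr w)
  have hlt : (e.biUnion (fun w => (powersetCard (r-1) (univ : Finset (Fin n))).filter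
      (fun S => w ∈ S))).card < (A ∩ B).card := by omega
  obtain ⟨S, hS, hSn⟩ := exists_mem_notMem_of_card_lt_card hlt
  rw [mem_inter] at hS
  have hSA := mem_filter.mp hS.1
  have hSB := mem_filter.mp hS.2
  have hSp := (mem_filter.mp hSA.1).1
  refine aux_triangle r hr H hfree e S x y he hec hx hy hxy (mem_powersetCard.mp hSp).2 ?_
    hSA.2 hSB.2
  rw [Finset.disjoint_left]
  intro w hw hwe
  exact hSn (mem_biUnion.mpr ⟨w, hwe, mem_filter.mpr ⟨hSp, hw⟩⟩)

open Finset in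
lemma aux_part (r n : ℕ) (P : Fin n → Fin r) (e : Finset (Fin n)) (hec : e.card = r) :
    (∀ k : Fin r, (e.filter (fun u => P u = k)).card = 1) ↔
      ∀ x ∈ e, ∀ y ∈ e, P x = P y → x = y := by
  constructor
  · intro h x hx y hy hxy
    exact card_le_one.mp (h (P y)).le x (mem_filter.mpr ⟨hx, hxy⟩) y (mem_filter.mpr ⟨hy, rfl⟩)
  · intro h k
    have himg : e.image P = univ := by
      apply eq_univ_of_card
      rw [card_image_of_injOn (fun x hx y hy h' => h x hx y hy h'), hec]; simp
    have hk : k ∈ e.image P := by rw [himg]; simp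
    obtain ⟨x, hx, rfl⟩ := mem_image.mp hk
    rw [card_eq_one]
    refine ⟨x, ?_⟩
    ext z
    simp only [mem_filter, mem_singleton]
    constructor
    · rintro ⟨hz, hzx⟩; exact h z hz x hx hzx
    · rintro rfl; exact ⟨hx, rfl⟩

open Finset in
/-- the degree of an ordinary vertex is controlled by its link. -/
lemma aux_deg (r n : ℕ) (hr : 2 ≤ r) (H : Finset (Finset (Fin n))) (P : Fin n → Fin r)
    (hu : ∀ e ∈ H, e.card = r) (v : Fin n)
    (hP : ∀ e ∈ H, v ∉ e → ∀ x ∈ e, ∀ y ∈ e, P x = P y → x = y) (u : Fin n) (huv : u ≠ v) :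
    (H.filter (fun e => u ∈ e)).card ≤ (LL r n H P (P u) u).card + n ^ (r-2) := by
  have h : (H.filter (fun e => u ∈ e)).card ≤ (LL r n H P (P u) u ∪
      (powersetCard (r-1) (univ : Finset (Fin n))).filter (fun S => v ∈ S)).card := by
    apply card_le_card_of_injOn (fun S => S.erase u)
    · intro e he
      simp only [coe_filter, Set.mem_ofPred_eq] at he
      obtain ⟨heH, hue⟩ := he
      have hc : (e.erase u).card = r - 1 := by rw [card_erase_of_mem hue, hu e heH]
      simp only [mem_coe, mem_union]
      by_cases hv : v ∈ e
      · right
        simp only [mem_filter, mem_powersetCard]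
        exact ⟨⟨subset_univ _, hc⟩, mem_erase.mpr ⟨huv.symm, hv⟩⟩
      · left
        simp only [LL, TT, mem_filter, mem_powersetCard]
        refine ⟨⟨⟨subset_univ _, hc⟩, ?_, ?_⟩, ?_⟩
        · intro x hx y hy
          exact hP e heH hv x (mem_of_mem_erase hx) y (mem_of_mem_erase hy)
        · intro x hx hxu
          exact (mem_erase.mp hx).1 (hP e heH hv x (mem_of_mem_erase hx) u hue hxu)
        · rw [insert_erase hue]; exact heH
    · intro S hS S' hS' heq
      simp only [coe_filter, Set.mem_ofPred_eq] at hS hS'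
      have heq' : S.erase u = S'.erase u := heq
      rw [← insert_erase hS.2, heq', insert_erase hS'.2]
  refine h.trans ((card_union_le _ _).trans ?_)
  have := aux_star r n hr v
  omega

open Finset in
/-- the degree of the exceptional vertex. -/
lemma aux_degv (r n : ℕ) (hr : 2 ≤ r) (H : Finset (Finset (Fin n))) (P : Fin n → Fin r)
    (hu : ∀ e ∈ H, e.card = r) (v : Fin n)
    (hP : ∀ e ∈ H, v ∈ e → ∀ x ∈ e.erase v, ∀ y ∈ e.erase v, P x = P y → x = y) :
    (H.filter (fun e => v ∈ e)).card ≤ ∑ i, (LL r n H P i v).card := by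
  have h : (H.filter (fun e => v ∈ e)).card ≤
      ((univ : Finset (Fin r)).biUnion (fun i => LL r n H P i v)).card := by
    apply card_le_card_of_injOn (fun S => S.erase v)
    · intro e he
      simp only [coe_filter, Set.mem_ofPred_eq] at he
      obtain ⟨heH, hue⟩ := he
      have hc : (e.erase v).card = r - 1 := by rw [card_erase_of_mem hue, hu e heH]
      have hlt : ((e.erase v).image P).card < (univ : Finset (Fin r)).card := by
        refine card_image_le.trans_lt ?_
        rw [hc, card_univ, Fintype.card_fin]; omega
      obtain ⟨i, _, hi⟩ := exists_mem_notMem_of_card_lt_card hlt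
      simp only [mem_coe, mem_biUnion]
      refine ⟨i, mem_univ _, ?_⟩
      simp only [LL, TT, mem_filter, mem_powersetCard]
      refine ⟨⟨⟨subset_univ _, hc⟩, hP e heH hue, ?_⟩, ?_⟩
      · intro x hx hxi
        exact hi (mem_image.mpr ⟨x, hx, hxi⟩)
      · rw [insert_erase hue]; exact heH
    · intro S hS S' hS' heq
      simp only [coe_filter, Set.mem_ofPred_eq] at hS hS'
      have heq' : S.erase v = S'.erase v := heq
      rw [← insert_erase hS.2, heq', insert_erase hS'.2]
  exact h.trans card_biUnion_le

set_option maxHeartbeats 2000000 in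
open Finset in
/-- `𝕋_{r,1}` is vertex-extendable with respect to the class of `r`-partite
`r`-graphs: there exist `ε > 0` and `n₀` such that every `𝕋_{r,1}`-free
`r`-graph `H` on `n ≥ n₀` vertices with `δ(H) ≥ n^{r-1}/r^{r-1} − ε n^{r-1}`
such that `H − v` is `r`-partite for some vertex `v` is itself `r`-partite. -/
theorem Tr1_vertex_extendable :
    ∀ r : ℕ, 2 ≤ r → ∃ ε > (0 : ℝ), ∃ n₀ : ℕ, ∀ n : ℕ, n₀ ≤ n →
      ∀ H : Finset (Finset (Fin n)), (∀ e ∈ H, e.card = r) → Tr1Free r H →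
        (∀ v : Fin n, (n : ℝ) ^ (r - 1) / (r : ℝ) ^ (r - 1) - ε * (n : ℝ) ^ (r - 1) ≤
          ((H.filter (fun e => v ∈ e)).card : ℝ)) →
        (∃ v : Fin n, RPartite r (H.filter (fun e => v ∉ e))) →
        RPartite r H := by
  intro r hr
  have hr' : (2 : ℝ) ≤ r := by exact_mod_cast hr
  have hr0 : (0 : ℝ) < r := by linarith
  set η : ℝ := 1 / (128 * (r : ℝ) ^ 2) with hη
  have hηpos : 0 < η := by positivity
  have hη1 : η * r ≤ 1 / 256 := by
    rw [hη, div_mul_eq_mul_div, div_le_div_iff₀ (by positivity) (by norm_num)]; nlinarith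
  have hη2 : η ≤ 1 / 512 := by nlinarith
  refine ⟨η / (r : ℝ) ^ (r - 1), by positivity,
    ⌈(r : ℝ) * (r : ℝ) ^ (r - 1) / η⌉₊ + 2, ?_⟩
  intro n hn H hu hfree hdeg ⟨v, P, hP0⟩
  have hn2 : 2 ≤ n := by omega
  have hnr : (0 : ℝ) < n := by exact_mod_cast (by omega : 0 < n)
  set Q : ℝ := (n : ℝ) ^ (r - 1) / (r : ℝ) ^ (r - 1) with hQ
  have hQpos : 0 < Q := by positivity
  have hM : (r : ℝ) * (n : ℝ) ^ (r - 2) ≤ η * Q := by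
    have h1 : (r : ℝ) * (r : ℝ) ^ (r - 1) / η ≤ n := by
      exact (Nat.le_ceil _).trans (Nat.cast_le.mpr (by omega))
    rw [div_le_iff₀ hηpos] at h1
    have h2 : (n : ℝ) ^ (r - 1) = n * (n : ℝ) ^ (r - 2) := by
      rw [← pow_succ']; congr 1; omega
    rw [hQ, h2, ← mul_div_assoc, le_div_iff₀ (by positivity)]
    have h3 : (0:ℝ) < (n : ℝ) ^ (r - 2) := by positivity
    nlinarith
  have hM0 : (0 : ℝ) < (n : ℝ) ^ (r - 2) := by positivity
  have hM1 : (n : ℝ) ^ (r - 2) ≤ η * Q := by nlinarith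
  have hdeg' : ∀ u : Fin n, (1 - η) * Q ≤ ((H.filter (fun e => u ∈ e)).card : ℝ) := by
    intro u
    refine le_trans (le_of_eq ?_) (hdeg u)
    rw [hQ]; ring
  have hP : ∀ e ∈ H, v ∉ e → ∀ x ∈ e, ∀ y ∈ e, P x = P y → x = y := by
    intro e he hv
    exact (aux_part r n P e (hu e he)).mp (hP0 e (mem_filter.mpr ⟨he, hv⟩))
  -- links of ordinary vertices are large
  have hL : ∀ u, u ≠ v → (1 - 2 * η) * Q ≤ ((LL r n H P (P u) u).card : ℝ) := by
    intro u huv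
    have h1 := aux_deg r n hr H P hu v hP u huv
    have h2 : ((H.filter (fun e => u ∈ e)).card : ℝ) ≤
      (LL r n H P (P u) u).card + (n : ℝ) ^ (r-2) := by exact_mod_cast h1
    have := hdeg' u
    linarith
  have hLp : ∀ i u, ((LL r n H P i u).card : ℝ) ≤ (TT r n P i).card := by
    intro i u; exact_mod_cast card_le_card (filter_subset _ _)
  -- every class contains an ordinary vertex
  have hne : ∀ i, ∃ u, u ≠ v ∧ P u = i := by
    obtain ⟨u, huv⟩ : ∃ u : Fin n, u ≠ v := by
      have : Nontrivial (Fin n) := Fin.nontrivial_iff_two_le.mpr hn2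
      exact exists_ne v
    have h1 := hL u huv
    have h2 : (0 : ℝ) < (LL r n H P (P u) u).card := by nlinarith
    have h3 : 0 < (LL r n H P (P u) u).card := by exact_mod_cast h2
    intro i
    have hpos : 0 < (H.filter (fun e => u ∈ e ∧ v ∉ e)).card := by
      by_contra hcon
      have hz : H.filter (fun e => u ∈ e ∧ v ∉ e) = ∅ := by
        rw [← card_eq_zero]; omega
      have hsub : (H.filter (fun e => u ∈ e)).card ≤ n ^ (r-2) := by
        refine le_trans ?_ (aux_star r n hr v)
        apply card_le_card_of_injOn (fun S => S.erase u)
        · intro e he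
          simp only [coe_filter, Set.mem_ofPred_eq] at he
          have hv : v ∈ e := by
            by_contra hv
            have : e ∈ H.filter (fun e => u ∈ e ∧ v ∉ e) := mem_filter.mpr ⟨he.1, he.2, hv⟩
            rw [hz] at this
            simp at this
          simp only [coe_filter, mem_powersetCard, Set.mem_ofPred_eq]
          refine ⟨⟨subset_univ _, ?_⟩, mem_erase.mpr ⟨huv.symm, hv⟩⟩
          rw [card_erase_of_mem he.2, hu e he.1]
        · intro S hS S' hS' heq
          simp only [coe_filter, Set.mem_ofPred_eq] at hS hS'
          have heq' : S.erase u = S'.erase u := heq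
          rw [← insert_erase hS.2, heq', insert_erase hS'.2]
      have hsub' : ((H.filter (fun e => u ∈ e)).card : ℝ) ≤ (n : ℝ) ^ (r-2) := by
        exact_mod_cast hsub
      have := hdeg' u
      nlinarith
    obtain ⟨e, he⟩ := card_pos.mp hpos
    rw [mem_filter] at he
    have hk := hP0 e (mem_filter.mpr ⟨he.1, he.2.2⟩) i
    obtain ⟨x, hx⟩ := card_pos.mp (by omega : 0 < (e.filter (fun u => P u = i)).card)
    rw [mem_filter] at hx
    exact ⟨x, fun h => he.2.2 (h ▸ hx.1), hx.2⟩
  -- upper bound on the number of transversals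
  have hT : ∀ i, ((TT r n P i).card : ℝ) ≤ (1 + 1 / (2 * (r : ℝ))) * Q := by
    set b : Fin r → ℝ := fun j => r / n * ((univ.filter (fun u => P u = j)).card : ℝ) with hb
    have hbp : ∀ i, (∏ j ∈ univ.erase i, b j) * Q =
        ((∏ j ∈ univ.erase i, (univ.filter (fun u => P u = j)).card : ℕ) : ℝ) := by
      intro i
      rw [hb, prod_mul_distrib, prod_const, card_erase_of_mem (mem_univ _), card_univ,
        Fintype.card_fin, hQ, Nat.cast_prod, div_pow]
      have ha : (r : ℝ) ^ (r - 1) ≠ 0 := by positivity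
      have hc : (n : ℝ) ^ (r - 1) ≠ 0 := by positivity
      generalize (r : ℝ) ^ (r - 1) = a at ha
      generalize (n : ℝ) ^ (r - 1) = c at hc
      rw [mul_right_comm, div_mul_div_comm, mul_comm a c, div_self (mul_ne_zero hc ha), one_mul]
    have hbs : ∑ i, b i = r := by
      have h1 : ∑ j : Fin r, (univ.filter (fun u => P u = j)).card = n := by
        have := card_eq_sum_card_fiberwise (f := P) (s := univ) (t := univ) (fun _ _ => by simp)
        simpa using this.symm
      rw [hb, ← mul_sum, ← Nat.cast_sum, h1]
      field_simp
    have hcT : ∀ i, ((TT r n P i).card : ℝ) ≤ (∏ j ∈ univ.erase i, b j) * Q := by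
      intro i
      rw [hbp]; exact_mod_cast aux_card r n P i v
    intro i
    refine (hcT i).trans (mul_le_mul_of_nonneg_right ?_ hQpos.le)
    refine aux_analytic r hr b (fun j => by positivity) hbs ?_ i
    intro k
    obtain ⟨u, huv, huk⟩ := hne k
    have h1 := (hL u huv).trans ((hLp (P u) u).trans (hcT _))
    rw [huk] at h1
    have h2 := le_of_mul_le_mul_right h1 hQpos
    refine le_trans (le_of_eq ?_) h2
    rw [hη]; field_simp; ring
  have hir : 1 / (2 * (r : ℝ)) ≤ 1 / 4 := by
    rw [div_le_div_iff₀ (by positivity) (by norm_num)]; linarith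
  -- edges through `v` meet every class at most once outside `v`
  have hA : ∀ e ∈ H, v ∈ e → ∀ x ∈ e.erase v, ∀ y ∈ e.erase v, P x = P y → x = y := by
    intro e he _ x hx y hy hxy
    by_contra hne'
    rw [mem_erase] at hx hy
    refine aux_common r n hr H P hfree e (P x) x y he (hu e he) hx.2 hy.2 hne' ?_
    have h1 := hL x hx.1
    have h2 := hL y hy.1
    rw [← hxy] at h2
    have h3 := hT (P x)
    have : ((TT r n P (P x)).card : ℝ) + r * (n : ℝ) ^ (r-2) <
      (LL r n H P (P x) x).card + (LL r n H P (P x) y).card := by nlinarith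
    exact_mod_cast this
  -- pigeonhole
  obtain ⟨i, hi⟩ : ∃ i, (1 - η) * Q / r ≤ ((LL r n H P i v).card : ℝ) := by
    by_contra hcon
    push Not at hcon
    have h1 := aux_degv r n hr H P hu v hA
    have h2 : ((H.filter (fun e => v ∈ e)).card : ℝ) ≤ ∑ i, ((LL r n H P i v).card : ℝ) := by
      exact_mod_cast h1
    have : Nonempty (Fin r) := ⟨⟨0, by omega⟩⟩
    have h3 : ∑ i, ((LL r n H P i v).card : ℝ) < ∑ i : Fin r, (1 - η) * Q / r :=
      sum_lt_sum_of_nonempty univ_nonempty (fun i _ => hcon i)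
    have h4 : ∑ i : Fin r, (1 - η) * Q / r = (1 - η) * Q := by
      simp; field_simp
    have := hdeg' v
    linarith
  have hB : ∀ e ∈ H, v ∈ e → ∀ x ∈ e.erase v, P x ≠ i := by
    intro e he hv x hx hxi
    rw [mem_erase] at hx
    refine aux_common r n hr H P hfree e i x v he (hu e he) hx.2 hv hx.1 ?_
    have h1 := hL x hx.1
    rw [hxi] at h1
    have h3 := hT i
    have h5 : (1 + 1 / (2 * (r : ℝ))) + η < (1 - 2 * η) + (1 - η) / r := by
      have : 3 * η + η / r < 1 / (2 * r) := by
        rw [← sub_pos]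
        have : 1 / (2 * (r:ℝ)) - (3 * η + η / r) = (1 / 2 - 3 * (η * r) - η) / r := by
          field_simp
          ring
        rw [this]
        apply div_pos _ hr0
        linarith
      have h6 : (1 - η) / r = 2 * (1 / (2 * r)) - η / r := by field_simp
      linarith
    have h7 := mul_lt_mul_of_pos_right h5 hQpos
    have h8 : (1 - η) * Q / r = (1 - η) / r * Q := by ring
    have : ((TT r n P i).card : ℝ) + r * (n : ℝ) ^ (r-2) <
      (LL r n H P i x).card + (LL r n H P i v).card := by
      rw [h8] at hi
      linarith
    exact_mod_cast this
  refine ⟨Function.update P v i, ?_⟩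
  intro e he
  rw [aux_part r n _ e (hu e he)]
  intro x hx y hy hxy
  by_cases hv : v ∈ e
  · by_cases hxv : x = v <;> by_cases hyv : y = v
    · rw [hxv, hyv]
    · subst hxv
      rw [Function.update_self, Function.update_of_ne hyv] at hxy
      exact absurd hxy.symm (hB e he hv y (mem_erase.mpr ⟨hyv, hy⟩))
    · subst hyv
      rw [Function.update_self, Function.update_of_ne hxv] at hxy
      exact absurd hxy (hB e he hv x (mem_erase.mpr ⟨hxv, hx⟩))
    · rw [Function.update_of_ne hxv, Function.update_of_ne hyv] at hxy
      exact hA e he hv x (mem_erase.mpr ⟨hxv, hx⟩) y (mem_erase.mpr ⟨hyv, hy⟩) hxy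
  · have hxv : x ≠ v := fun h => hv (h ▸ hx)
    have hyv : y ≠ v := fun h => hv (h ▸ hy)
    rw [Function.update_of_ne hxv, Function.update_of_ne hyv] at hxy
    exact hP e he hv x hx y hy hxy
end

section
/- There exist ε > 0 and N₀ such that for all n ≥ N₀: every symmetrized T_r-free r-graph H on n vertices with δ(H) ≥ n^{r−1}/r^{r−1} − ε n^{r−1} is r-partite. -/
/-- An `r`-graph is `𝒯_r`-free if it contains no three (distinct) edges `A, B, C`
with `A ⊆ B ∪ C` and `(B ∩ C) \ A ≠ ∅`. -/
def TriangleFree {V : Type*} [DecidableEq V] (H : Finset (Finset V)) : Prop :=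
  ¬ ∃ A ∈ H, ∃ B ∈ H, ∃ C ∈ H, A ≠ B ∧ A ≠ C ∧ B ≠ C ∧
      A ⊆ B ∪ C ∧ ((B ∩ C) \ A).Nonempty

/-- An `r`-graph `H` on `n` vertices is symmetrized if it is a blowup
`G[V₁,…,V_m]` of some `2`-covered `r`-graph `G`, where `V₁ ∪ ⋯ ∪ V_m` is a
partition of the vertex set of `H`. -/
def Symmetrized (r n : ℕ) (H : Finset (Finset (Fin n))) : Prop :=
  ∃ m : ℕ, ∃ G : Finset (Finset (Fin m)),
    (∀ e ∈ G, e.card = r) ∧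
    (∀ u v : Fin m, u ≠ v → ∃ e ∈ G, u ∈ e ∧ v ∈ e) ∧
    ∃ V : Fin m → Finset (Fin n),
      (∀ i j : Fin m, i ≠ j → Disjoint (V i) (V j)) ∧
      (∀ u : Fin n, ∃ i, u ∈ V i) ∧
      ∀ T : Finset (Fin n),
        T ∈ H ↔ ∃ e ∈ G, T ⊆ e.biUnion V ∧ ∀ i ∈ e, (T ∩ V i).card = 1


open Finset

namespace TR

/-- Superadditive sequences: the sum of `x_k / k` is at most the last term. -/
lemma superadd_sum (r : ℕ) (x : ℕ → ℝ)
    (hx : ∀ i j, 1 ≤ i → 1 ≤ j → i + j ≤ r → x i + x j ≤ x (i + j)) :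
    ∀ m, m + 1 ≤ r → ∑ k ∈ range (m + 1), x (k + 1) / ((k : ℝ) + 1) ≤ x (m + 1) := by
  intro m
  induction m using Nat.strong_induction_on with
  | _ m ih =>
    intro hm
    -- sum of partial sums
    have h1 : ∑ l ∈ range m, ∑ k ∈ range (l + 1), x (k + 1) / ((k : ℝ) + 1)
        ≤ ∑ l ∈ range m, x (l + 1) := by
      apply Finset.sum_le_sum
      intro l hl
      rw [mem_range] at hl
      exact ih l hl (by omega)
    have h2 : ∀ p : ℕ, ∑ l ∈ range p, ∑ k ∈ range (l + 1), x (k + 1) / ((k : ℝ) + 1)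
        = ((p : ℝ) + 1) * ∑ k ∈ range p, x (k + 1) / ((k : ℝ) + 1)
          - ∑ k ∈ range p, x (k + 1) := by
      intro p
      induction p with
      | zero => simp
      | succ p ihp =>
        rw [Finset.sum_range_succ, ihp, Finset.sum_range_succ, Finset.sum_range_succ]
        have : (p : ℝ) + 1 ≠ 0 := by positivity
        push_cast
        field_simp
        ring
    have h3 : 2 * ∑ l ∈ range m, x (l + 1) ≤ m * x (m + 1) := by
      have e1 : ∑ l ∈ range m, x (m - 1 - l + 1) = ∑ l ∈ range m, x (l + 1) :=
        Finset.sum_range_reflect (fun l => x (l + 1)) m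
      have e2 : ∑ l ∈ range m, (x (l + 1) + x (m - 1 - l + 1)) ≤ ∑ l ∈ range m, x (m + 1) := by
        apply Finset.sum_le_sum
        intro l hl
        rw [mem_range] at hl
        have := hx (l + 1) (m - 1 - l + 1) (by omega) (by omega) (by omega)
        rwa [show l + 1 + (m - 1 - l + 1) = m + 1 by omega] at this
      rw [Finset.sum_add_distrib, e1, Finset.sum_const, card_range, nsmul_eq_mul] at e2
      linarith
    rw [h2] at h1
    rw [Finset.sum_range_succ]
    have hm0 : (0 : ℝ) < (m : ℝ) + 1 := by positivity
    have h4 : ((m : ℝ) + 1) * (∑ k ∈ range m, x (k + 1) / ((k : ℝ) + 1)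
        + x (m + 1) / ((m : ℝ) + 1)) ≤ ((m : ℝ) + 1) * x (m + 1) := by
      rw [mul_add, mul_div_cancel₀ _ hm0.ne']
      linarith
    exact le_of_mul_le_mul_left h4 hm0

variable {n : ℕ}

/-- Vertices extending `S` inside some edge. -/
def W (H : Finset (Finset (Fin n))) (S : Finset (Fin n)) : Finset (Fin n) :=
  univ.filter (fun x => x ∉ S ∧ ∃ B ∈ H, insert x S ⊆ B)

lemma mem_W {H : Finset (Finset (Fin n))} {S : Finset (Fin n)} {x : Fin n} :
    x ∈ W H S ↔ x ∉ S ∧ ∃ B ∈ H, insert x S ⊆ B := by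
  simp [W]

/-- Sequential sampling weights sum to at most one. -/
lemma sum_weights_le_one (H : Finset (Finset (Fin n))) : ∀ k : ℕ,
    ∑ f : Fin k → Fin n, ∏ i : Fin k,
      (if f i ∈ W H ((Ioi i).image f) then ((W H ((Ioi i).image f)).card : ℝ)⁻¹ else 0) ≤ 1 := by
  intro k
  induction k with
  | zero => simp
  | succ k ih =>
    rw [← (Fin.consEquiv (fun _ : Fin (k + 1) => Fin n)).sum_comp, Fintype.sum_prod_type_right]
    refine le_trans (Finset.sum_le_sum ?_) ih
    intro g _
    have key : ∀ v : Fin n, (∏ i : Fin (k + 1),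
        (if (Fin.cons v g : Fin (k + 1) → Fin n) i ∈ W H ((Ioi i).image (Fin.cons v g : Fin (k + 1) → Fin n))
          then ((W H ((Ioi i).image (Fin.cons v g : Fin (k + 1) → Fin n))).card : ℝ)⁻¹ else 0))
        = (if v ∈ W H (univ.image g) then ((W H (univ.image g)).card : ℝ)⁻¹ else 0) *
          ∏ i : Fin k, (if g i ∈ W H ((Ioi i).image g) then
            ((W H ((Ioi i).image g)).card : ℝ)⁻¹ else 0) := by
      intro v
      rw [Fin.prod_univ_succ]
      have h0 : (Ioi (0 : Fin (k + 1))).image (Fin.cons v g : Fin (k + 1) → Fin n) = univ.image g := by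
        ext x
        simp [Fin.exists_fin_succ]
      have hs : ∀ i : Fin k, (Ioi i.succ).image (Fin.cons v g : Fin (k + 1) → Fin n)
          = (Ioi i).image g := by
        intro i
        ext x
        simp [Fin.exists_fin_succ]
      simp only [h0, hs, Fin.cons_zero, Fin.cons_succ]
    have : ∀ v : Fin n, (Fin.consEquiv (fun _ : Fin (k + 1) => Fin n)) (v, g)
      = (Fin.cons v g : Fin (k + 1) → Fin n) := fun v => rfl
    simp only [this, key]
    rw [← Finset.sum_mul]
    have hp : 0 ≤ ∏ i : Fin k, (if g i ∈ W H ((Ioi i).image g) then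
            ((W H ((Ioi i).image g)).card : ℝ)⁻¹ else 0) := by
      apply Finset.prod_nonneg
      intro i _
      split_ifs <;> positivity
    have hs : ∑ v : Fin n, (if v ∈ W H (univ.image g) then
        ((W H (univ.image g)).card : ℝ)⁻¹ else 0) ≤ 1 := by
      rw [← Finset.sum_filter, Finset.sum_const, nsmul_eq_mul, Finset.filter_mem_eq_inter,
        Finset.univ_inter]
      exact mul_inv_le_one
    calc _ ≤ 1 * _ := mul_le_mul_of_nonneg_right hs hp
      _ = _ := one_mul _

/-- Ordered edges. -/
def E (r : ℕ) (H : Finset (Finset (Fin n))) : Finset (Fin r → Fin n) :=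
  univ.filter (fun f => Function.Injective f ∧ univ.image f ∈ H)

lemma mem_E {r : ℕ} {H : Finset (Finset (Fin n))} {f : Fin r → Fin n} :
    f ∈ E r H ↔ Function.Injective f ∧ univ.image f ∈ H := by
  simp [E]

lemma sum_E_comp {r : ℕ} (H : Finset (Finset (Fin n))) (τ : Equiv.Perm (Fin r))
    (F : (Fin r → Fin n) → ℝ) : ∑ f ∈ E r H, F (f ∘ τ) = ∑ f ∈ E r H, F f := by
  apply Finset.sum_equiv (Equiv.arrowCongr τ.symm (Equiv.refl (Fin n)))
  · intro f
    simp only [mem_E]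
    have h1 : (Equiv.arrowCongr τ.symm (Equiv.refl (Fin n))) f = f ∘ τ := by
      ext; simp [Equiv.arrowCongr]
    rw [h1]
    have h2 : univ.image (f ∘ τ) = univ.image f := by
      rw [← Finset.image_image]; simp
    rw [h2, τ.injective_comp]
  · intro f _
    congr 1

lemma exists_perm {r : ℕ} (X Y : Finset (Fin r)) (h : X.card = Y.card) :
    ∃ τ : Equiv.Perm (Fin r), X.image τ = Y := by
  refine ⟨(Finset.equivOfCardEq h).extendSubtype, ?_⟩
  apply Finset.eq_of_subset_of_card_le
  · intro y hy
    rw [mem_image] at hy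
    obtain ⟨x, hx, rfl⟩ := hy
    exact Equiv.extendSubtype_mem (Finset.equivOfCardEq h) x hx
  · rw [Finset.card_image_of_injective _ (Equiv.injective _), h]

lemma sum_E_card {r : ℕ} (H : Finset (Finset (Fin n))) (X Y : Finset (Fin r))
    (h : X.card = Y.card) (F : Finset (Fin n) → ℝ) :
    ∑ f ∈ E r H, F (X.image f) = ∑ f ∈ E r H, F (Y.image f) := by
  obtain ⟨τ, hτ⟩ := exists_perm X Y h
  rw [← sum_E_comp H τ (fun f => F (X.image f))]
  · simp only [← Finset.image_image, hτ]

lemma factorial_mul_le_card_E {r : ℕ} (H : Finset (Finset (Fin n))) (hH : ∀ e ∈ H, e.card = r) :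
    H.card * r.factorial ≤ (E r H).card := by
  classical
  have hc : (H.attach ×ˢ (univ : Finset (Equiv.Perm (Fin r)))).card = H.card * r.factorial := by
    rw [card_product, card_attach, card_univ, Fintype.card_perm, Fintype.card_fin]
  rw [← hc]
  have himg : ∀ p : {e // e ∈ H} × Equiv.Perm (Fin r),
      univ.image ((p.1.1.orderEmbOfFin (hH _ p.1.2)) ∘ p.2) = p.1.1 := by
    intro p
    rw [← Finset.image_image, Finset.image_univ_equiv, Finset.image_orderEmbOfFin_univ]
  apply Finset.card_le_card_of_injOn
    (fun p => (p.1.1.orderEmbOfFin (hH _ p.1.2)) ∘ p.2)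
  · intro p _
    simp only [mem_coe, mem_E]
    rw [himg]
    exact ⟨(RelEmbedding.injective _).comp p.2.injective, p.1.2⟩
  · intro p _ q _ hpq
    have h1 := himg p
    have h2 := himg q
    simp only at hpq
    rw [hpq, h2] at h1
    obtain ⟨⟨e, he⟩, π⟩ := p
    obtain ⟨⟨e', he'⟩, π'⟩ := q
    simp only at h1
    subst h1
    congr 1
    ext i
    have := congrFun hpq i
    simp only [Function.comp] at this
    rw [(RelEmbedding.injective _) this]

lemma sum_deg {r : ℕ} (H : Finset (Finset (Fin n))) (hH : ∀ e ∈ H, e.card = r) :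
    ∑ v : Fin n, (H.filter (fun e => v ∈ e)).card = H.card * r := by
  have h := Finset.sum_card_bipartiteAbove_eq_sum_card_bipartiteBelow (s := (univ : Finset (Fin n)))
    (t := H) (fun v e => v ∈ e)
  simp only [Finset.bipartiteAbove, Finset.bipartiteBelow] at h
  rw [h, Finset.sum_congr rfl (g := fun _ => r), Finset.sum_const, smul_eq_mul]
  intro e he
  simp [hH e he]


lemma no_tri {r : ℕ} {H : Finset (Finset (Fin n))} (hH : ∀ e ∈ H, e.card = r)
    (hT : TriangleFree H) {A B C : Finset (Fin n)} (hA : A ∈ H) (hB : B ∈ H) (hC : C ∈ H)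
    (hsub : A ⊆ B ∪ C) {x : Fin n} (hxB : x ∈ B) (hxC : x ∈ C) (hxA : x ∉ A) : False := by
  apply hT
  refine ⟨A, hA, B, hB, C, hC, ?_, ?_, ?_, hsub, x, ?_⟩
  · rintro rfl; exact hxA hxB
  · rintro rfl; exact hxA hxC
  · rintro rfl
    rw [union_self] at hsub
    have := Finset.eq_of_subset_of_card_le hsub (by rw [hH _ hA, hH _ hB])
    subst this
    exact hxA hxB
  · simp [hxA, hxB, hxC]

lemma W_disj {r : ℕ} {H : Finset (Finset (Fin n))} (hH : ∀ e ∈ H, e.card = r) (hT : TriangleFree H)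
    (f : Fin r → Fin n) (hf : f ∈ E r H) (X Y : Finset (Fin r)) (hXY : X ∪ Y = univ) :
    Disjoint (W H (X.image f)) (W H (Y.image f)) := by
  rw [mem_E] at hf
  obtain ⟨hinj, hfH⟩ := hf
  have himg : X.image f ∪ Y.image f = univ.image f := by rw [← image_union, hXY]
  rw [Finset.disjoint_left]
  intro x hx hy
  rw [mem_W] at hx hy
  obtain ⟨h1, B, hB, h2⟩ := hx
  obtain ⟨h3, C, hC, h4⟩ := hy
  have hxA : x ∉ univ.image f := by
    rw [← himg, mem_union]; tauto
  have hxB : x ∈ B := h2 (mem_insert_self _ _)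
  have hxC : x ∈ C := h4 (mem_insert_self _ _)
  have hsub : univ.image f ⊆ B ∪ C := by
    rw [← himg]
    exact union_subset_union ((subset_insert _ _).trans h2) ((subset_insert _ _).trans h4)
  exact no_tri hH hT hfH hB hC hsub hxB hxC hxA

lemma W_superadd {r : ℕ} {H : Finset (Finset (Fin n))} (hH : ∀ e ∈ H, e.card = r) (hT : TriangleFree H)
    (f : Fin r → Fin n) (hf : f ∈ E r H) (X Y : Finset (Fin r)) (hXY : X ∪ Y = univ) :
    (W H (X.image f)).card + (W H (Y.image f)).card ≤ (W H ((X ∩ Y).image f)).card := by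
  rw [← card_union_of_disjoint]
  · apply card_le_card
    have hmono : ∀ S T : Finset (Fin n), S ⊆ T → W H T ⊆ W H S := by
      intro S T hST x hx
      rw [mem_W] at hx ⊢
      obtain ⟨h1, B, hB, h2⟩ := hx
      exact ⟨fun h => h1 (hST h), B, hB, (insert_subset_insert _ hST).trans h2⟩
    exact union_subset (hmono _ _ (image_subset_image inter_subset_left))
      (hmono _ _ (image_subset_image inter_subset_right))
  · exact W_disj hH hT f hf X Y hXY

/-- The inverse is bounded below by an exponential. -/
lemma exp_le_inv {y : ℝ} (hy : 0 < y) : Real.exp (2 - 2 * √y) ≤ y⁻¹ := by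
  have h1 : √y ≤ Real.exp (√y - 1) := by
    have := Real.add_one_le_exp (√y - 1); linarith
  have h2 : y ≤ Real.exp (2 * √y - 2) := by
    calc y = √y * √y := (Real.mul_self_sqrt hy.le).symm
      _ ≤ Real.exp (√y - 1) * Real.exp (√y - 1) := by gcongr
      _ = _ := by rw [← Real.exp_add]; congr 1; ring
  rw [show 2 - 2 * √y = -(2 * √y - 2) by ring, Real.exp_neg]
  gcongr

/-- normalised extension ratio -/
noncomputable def Y {r : ℕ} (H : Finset (Finset (Fin n))) (f : Fin r → Fin n) (i : Fin r) : ℝ :=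
  (r : ℝ) * (W H ((Ioi i).image f)).card / (((i : ℕ) + 1 : ℝ) * n)

lemma sum_Y_le {r : ℕ} (hr : 2 ≤ r) (hn : 1 ≤ n) {H : Finset (Finset (Fin n))}
    (hH : ∀ e ∈ H, e.card = r) (hT : TriangleFree H) :
    ∑ f ∈ E r H, ∑ i : Fin r, Y H f i ≤ (r : ℝ) * (E r H).card := by
  have hn0 : (0 : ℝ) < n := by exact_mod_cast hn
  -- initial segments
  let x : ℕ → ℝ := fun m => ∑ f ∈ E r H,
    ((W H ((univ.filter (fun i : Fin r => m ≤ (i : ℕ))).image f)).card : ℝ)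
  have hcard : ∀ m, m ≤ r → (univ.filter (fun i : Fin r => m ≤ (i : ℕ))).card = r - m := by
    intro m hm
    have h := Fin.card_filter_val_lt (n := r) (m := m)
    have h2 := Finset.card_filter_add_card_filter_not (s := (univ : Finset (Fin r)))
      (fun i : Fin r => (i : ℕ) < m)
    simp only [not_lt, card_univ, Fintype.card_fin] at h2
    omega
  have hsup : ∀ i j, 1 ≤ i → 1 ≤ j → i + j ≤ r → x i + x j ≤ x (i + j) := by
    intro i j hi hj hij
    let A : Finset (Fin r) := univ.filter (fun t => i ≤ (t : ℕ))
    let B : Finset (Fin r) := univ.filter (fun t => (t : ℕ) < i ∨ i + j ≤ (t : ℕ))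
    have hAB : A ∪ B = univ := by
      ext t; simp only [A, B, mem_union, mem_filter, mem_univ, true_and, iff_true]; omega
    have hABi : A ∩ B = univ.filter (fun t : Fin r => i + j ≤ (t : ℕ)) := by
      ext t; simp only [A, B, mem_inter, mem_filter, mem_univ, true_and]; omega
    have hBc : B.card = (univ.filter (fun t : Fin r => j ≤ (t : ℕ))).card := by
      have h1 := Finset.card_union_add_card_inter A B
      rw [hAB, hABi, hcard _ hij, card_univ, Fintype.card_fin] at h1
      have h2 : A.card = r - i := hcard i (by omega)
      rw [hcard j (by omega)]
      omega
    have hxj : x j = ∑ f ∈ E r H, ((W H (B.image f)).card : ℝ) :=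
      (sum_E_card H B _ hBc (fun S => ((W H S).card : ℝ))).symm
    rw [hxj]
    show ∑ f ∈ E r H, ((W H (A.image f)).card : ℝ) + _ ≤ _
    rw [← Finset.sum_add_distrib]
    apply Finset.sum_le_sum
    intro f hf
    have := W_superadd hH hT f hf A B hAB
    rw [hABi] at this
    exact_mod_cast this
  have hmain := superadd_sum r x hsup (r - 1) (by omega)
  rw [show r - 1 + 1 = r by omega] at hmain
  have hxr : x r ≤ (E r H).card * n := by
    have : ∀ f ∈ E r H, ((W H ((univ.filter (fun i : Fin r => r ≤ (i : ℕ))).image f)).card : ℝ) ≤ n := by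
      intro f _
      exact_mod_cast (card_le_univ _).trans (by simp)
    have := Finset.sum_le_card_nsmul _ _ _ this
    rwa [nsmul_eq_mul] at this
  have hIoi : ∀ i : Fin r, Ioi i = univ.filter (fun t : Fin r => (i : ℕ) + 1 ≤ (t : ℕ)) := by
    intro i; ext t; rw [mem_Ioi, mem_filter, Fin.lt_def]; simp
  have hY : ∑ f ∈ E r H, ∑ i : Fin r, Y H f i =
      (r : ℝ) / n * ∑ k ∈ range r, x (k + 1) / ((k : ℝ) + 1) := by
    rw [Finset.sum_comm, ← Fin.sum_univ_eq_sum_range (fun k => x (k + 1) / ((k : ℝ) + 1)),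
      Finset.mul_sum]
    apply Finset.sum_congr rfl
    intro i _
    simp only [Y, x, hIoi]
    rw [Finset.sum_div, Finset.mul_sum]
    apply Finset.sum_congr rfl
    intro f _
    have : ((i : ℕ) : ℝ) + 1 ≠ 0 := by positivity
    field_simp
  rw [hY]
  calc (r : ℝ) / n * ∑ k ∈ range r, x (k + 1) / ((k : ℝ) + 1)
      ≤ (r : ℝ) / n * ((E r H).card * n) := by gcongr; exact hmain.trans hxr
    _ = _ := by field_simp

lemma main_ineq {r : ℕ} (hr : 2 ≤ r) (hn : 1 ≤ n) {H : Finset (Finset (Fin n))}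
    (hH : ∀ e ∈ H, e.card = r) (hT : TriangleFree H) :
    (E r H).card + ∑ f ∈ E r H, ∑ i : Fin r, (1 - √(Y H f i)) ^ 2
      ≤ (r.factorial : ℝ) * (n : ℝ) ^ r / (r : ℝ) ^ r := by
  have hn0 : (0 : ℝ) < n := by exact_mod_cast hn
  have hr0 : (0 : ℝ) < r := by positivity
  have hmem : ∀ f ∈ E r H, ∀ i, f i ∈ W H ((Ioi i).image f) := by
    intro f hf i
    rw [mem_E] at hf
    rw [mem_W]
    refine ⟨?_, univ.image f, hf.2, ?_⟩
    · intro h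
      rw [mem_image] at h
      obtain ⟨j, hj, hji⟩ := h
      rw [hf.1 hji] at hj
      simp at hj
    · intro x hx
      rw [mem_insert, mem_image] at hx
      rcases hx with rfl | ⟨j, _, rfl⟩ <;> simp
  have hYpos : ∀ f ∈ E r H, ∀ i, 0 < Y H f i := by
    intro f hf i
    have : 0 < (W H ((Ioi i).image f)).card := card_pos.2 ⟨_, hmem f hf i⟩
    unfold Y
    positivity
  have hsum : ∑ f ∈ E r H, ∏ i : Fin r, ((W H ((Ioi i).image f)).card : ℝ)⁻¹ ≤ 1 := by
    refine le_trans ?_ (sum_weights_le_one H r)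
    refine le_trans (Finset.sum_le_sum ?_) (Finset.sum_le_sum_of_subset_of_nonneg
      (Finset.subset_univ (E r H)) ?_)
    · intro f hf
      apply le_of_eq
      apply Finset.prod_congr rfl
      intro i _
      rw [if_pos (hmem f hf i)]
    · intro f _ _
      apply Finset.prod_nonneg
      intro i _
      split_ifs <;> positivity
  have hprod : ∀ f : Fin r → Fin n, ∏ i : Fin r, (Y H f i)⁻¹ =
      (r.factorial : ℝ) * (n : ℝ) ^ r / (r : ℝ) ^ r *
        ∏ i : Fin r, ((W H ((Ioi i).image f)).card : ℝ)⁻¹ := by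
    intro f
    have h1 : ∀ i : Fin r, (Y H f i)⁻¹ = ((((i : ℕ) + 1 : ℕ) : ℝ) * (n / r)) *
        ((W H ((Ioi i).image f)).card : ℝ)⁻¹ := by
      intro i
      unfold Y
      rw [inv_div, div_eq_mul_inv, mul_inv]
      push_cast
      ring
    simp only [h1]
    rw [Finset.prod_mul_distrib, Finset.prod_mul_distrib, Finset.prod_const, card_univ,
      Fintype.card_fin, Fin.prod_univ_eq_prod_range (fun i => ((i + 1 : ℕ) : ℝ)),
      ← Nat.cast_prod, Finset.prod_range_add_one_eq_factorial, div_pow]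
    ring
  have hpt : ∀ f ∈ E r H, 1 + ∑ i : Fin r, ((1 - Y H f i) + (1 - √(Y H f i)) ^ 2) ≤
      ∏ i : Fin r, (Y H f i)⁻¹ := by
    intro f hf
    have h1 : ∏ i : Fin r, Real.exp (2 - 2 * √(Y H f i)) ≤ ∏ i : Fin r, (Y H f i)⁻¹ := by
      apply Finset.prod_le_prod
      · intro i _; positivity
      · intro i _; exact exp_le_inv (hYpos f hf i)
    rw [← Real.exp_sum] at h1
    refine le_trans ?_ h1
    have h2 := Real.add_one_le_exp (∑ i : Fin r, (2 - 2 * √(Y H f i)))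
    refine le_trans (le_of_eq ?_) h2
    rw [add_comm]
    congr 1
    apply Finset.sum_congr rfl
    intro i _
    have := Real.sq_sqrt (hYpos f hf i).le
    linear_combination this
  have h3 := Finset.sum_le_sum hpt
  simp only [hprod] at h3
  rw [← Finset.mul_sum] at h3
  have h4 : (r.factorial : ℝ) * (n : ℝ) ^ r / (r : ℝ) ^ r *
      ∑ f ∈ E r H, ∏ i : Fin r, ((W H ((Ioi i).image f)).card : ℝ)⁻¹ ≤
      (r.factorial : ℝ) * (n : ℝ) ^ r / (r : ℝ) ^ r * 1 := by gcongr
  have h5 := sum_Y_le hr hn hH hT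
  simp only [Finset.sum_add_distrib, Finset.sum_sub_distrib, Finset.sum_const, card_univ,
    Fintype.card_fin, nsmul_eq_mul, mul_one] at h3
  linarith


lemma good_edge {r : ℕ} (hr : 2 ≤ r) (hn : 1 ≤ n) {H : Finset (Finset (Fin n))}
    (hH : ∀ e ∈ H, e.card = r) (hT : TriangleFree H) (ε : ℝ) (hε : 0 < ε)
    (hε2 : ε ≤ 1 / (2 * (r : ℝ) ^ (r - 1)))
    (hdeg : ∀ v : Fin n, (n : ℝ) ^ (r - 1) / (r : ℝ) ^ (r - 1) - ε * (n : ℝ) ^ (r - 1) ≤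
          ((H.filter (fun e => v ∈ e)).card : ℝ)) :
    ∃ f ∈ E r H, ∀ i, (1 - 2 * √(2 * (r : ℝ) ^ r * ε)) * (n / r) ≤
      (W H ((univ.erase i).image f)).card := by
  have hn0 : (0 : ℝ) < n := by exact_mod_cast hn
  have hr0 : (0 : ℝ) < r := by positivity
  have hrr : (r : ℝ) ^ r = r ^ (r - 1) * r := by rw [← pow_succ]; congr 1; omega
  have hnr : (n : ℝ) ^ r = n ^ (r - 1) * n := by rw [← pow_succ]; congr 1; omega
  set ρ : ℝ := (r : ℝ) ^ (r - 1) with hρ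
  have hρ0 : 0 < ρ := by positivity
  set q : ℝ := (r.factorial : ℝ) / r * (n : ℝ) ^ r with hq
  have hq0 : 0 < q := by positivity
  have h1 : (n : ℝ) * ((n : ℝ) ^ (r - 1) / ρ - ε * (n : ℝ) ^ (r - 1)) ≤ H.card * r := by
    have h := Finset.card_nsmul_le_sum (univ : Finset (Fin n)) _ _ (fun v _ => hdeg v)
    rw [card_univ, Fintype.card_fin, nsmul_eq_mul] at h
    refine h.trans (le_of_eq ?_)
    exact_mod_cast sum_deg H hH
  have h2 : (H.card : ℝ) * r.factorial ≤ (E r H).card := by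
    exact_mod_cast factorial_mul_le_card_E H hH
  have h3 : q * (1 / ρ - ε) ≤ (E r H).card := by
    refine le_trans ?_ h2
    have : q * (1 / ρ - ε) = (r.factorial : ℝ) / r *
        ((n : ℝ) * ((n : ℝ) ^ (r - 1) / ρ - ε * (n : ℝ) ^ (r - 1))) := by
      rw [hq, hnr]; ring
    rw [this]
    calc _ ≤ (r.factorial : ℝ) / r * (H.card * r) := by gcongr
      _ = _ := by field_simp
  have h4 := main_ineq hr hn hH hT
  have h5 : (r.factorial : ℝ) * (n : ℝ) ^ r / (r : ℝ) ^ r = q * (1 / ρ) := by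
    rw [hq, hrr]; field_simp
  rw [h5] at h4
  have h6 : ∑ f ∈ E r H, ∑ i : Fin r, (1 - √(Y H f i)) ^ 2 ≤ q * ε := by linarith
  have h7 : q * ε ≤ 2 * ρ * ε * (E r H).card := by
    have : 1 / (2 * ρ) ≤ 1 / ρ - ε := by
      have : 1 / ρ = 1 / (2 * ρ) + 1 / (2 * ρ) := by field_simp; norm_num
      linarith
    have h8 : q * (1 / (2 * ρ)) ≤ (E r H).card := le_trans (by gcongr) h3
    calc q * ε = 2 * ρ * ε * (q * (1 / (2 * ρ))) := by field_simp
      _ ≤ _ := by gcongr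
  have hE0 : (0 : ℝ) < (E r H).card := by
    have : 0 < q * ε := by positivity
    by_contra hcon
    have h0 : ((E r H).card : ℝ) = 0 := le_antisymm (not_lt.1 hcon) (by positivity)
    rw [h0] at h7
    linarith
  have hne : (E r H).Nonempty := card_pos.1 (by exact_mod_cast hE0)
  let z : Fin r := ⟨0, by omega⟩
  let F : Finset (Fin n) → ℝ := fun S => (1 - √((r : ℝ) * (W H S).card / n)) ^ 2
  have hF : ∀ i : Fin r, ∑ f ∈ E r H, F ((univ.erase i).image f) ≤ q * ε := by
    intro i
    rw [sum_E_card H (univ.erase i) (Ioi z) (by simp [z]) F]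
    refine le_trans (Finset.sum_le_sum ?_) h6
    intro f _
    refine le_trans (le_of_eq ?_) (Finset.single_le_sum (f := fun i => (1 - √(Y H f i)) ^ 2)
      (fun i _ => sq_nonneg _) (mem_univ z))
    simp [F, Y, z]
  have hsum : ∑ f ∈ E r H, ∑ i : Fin r, F ((univ.erase i).image f) ≤
      ∑ f ∈ E r H, 2 * (r : ℝ) ^ r * ε := by
    rw [Finset.sum_comm]
    have := Finset.sum_le_card_nsmul univ _ _ (fun i _ => hF i)
    rw [card_univ, Fintype.card_fin, nsmul_eq_mul] at this
    refine this.trans ?_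
    rw [Finset.sum_const, nsmul_eq_mul, hrr]
    calc (r : ℝ) * (q * ε) ≤ r * (2 * ρ * ε * (E r H).card) := by gcongr
      _ = _ := by ring
  obtain ⟨f, hf, hfle⟩ := Finset.exists_le_of_sum_le hne hsum
  refine ⟨f, hf, fun i => ?_⟩
  have h9 : F ((univ.erase i).image f) ≤ 2 * (r : ℝ) ^ r * ε :=
    le_trans (Finset.single_le_sum (f := fun i => F ((univ.erase i).image f))
      (fun i _ => sq_nonneg _) (mem_univ i)) hfle
  simp only [F] at h9
  have h10 := Real.le_sqrt_of_sq_le h9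
  set s := √(2 * (r : ℝ) ^ r * ε)
  set w : ℝ := ((W H ((univ.erase i).image f)).card : ℝ) with hw
  have hw0 : 0 ≤ w := by positivity
  have h11 := Real.sq_sqrt (show 0 ≤ (r : ℝ) * w / n by positivity)
  have h12 : 1 - 2 * s ≤ r * w / n := by
    rw [← h11]; nlinarith [sq_nonneg (√((r : ℝ) * w / n) - 1)]
  calc (1 - 2 * s) * (n / r) ≤ (r * w / n) * (n / r) := by gcongr
    _ = w := by field_simp

lemma no_common_link {r : ℕ} {H : Finset (Finset (Fin n))} (hH : ∀ e ∈ H, e.card = r)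
    (hT : TriangleFree H) {u v : Fin n} (huv : u ≠ v) {T C : Finset (Fin n)}
    (hu : u ∉ T) (huT : insert u T ∈ H) (hvT : insert v T ∈ H)
    (hC : C ∈ H) (huC : u ∈ C) (hvC : v ∈ C) : False := by
  refine no_tri hH hT hvT huT hC ?_ (mem_insert_self u T) huC ?_
  · intro x hx
    rw [mem_insert] at hx
    rcases hx with rfl | hx
    · simp [hvC]
    · simp [hx]
  · simp [huv, hu]

/-- Transversals missing the class `i`. -/
def Trans {r : ℕ} (V : Fin r → Finset (Fin n)) (i : Fin r) : Finset (Finset (Fin n)) :=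
  (Fintype.piFinset (fun k : {k : Fin r // k ≠ i} => V k.1)).image (fun g => univ.image g)

lemma card_Trans_le {r : ℕ} (V : Fin r → Finset (Fin n)) (i : Fin r) (b : ℝ)
    (hb : ∀ k, ((V k).card : ℝ) ≤ b) : ((Trans V i).card : ℝ) ≤ b ^ (r - 1) := by
  have h1 : (Trans V i).card ≤ ∏ k : {k : Fin r // k ≠ i}, (V k.1).card := by
    rw [← Fintype.card_piFinset]; exact card_image_le
  calc ((Trans V i).card : ℝ) ≤ ((∏ k : {k : Fin r // k ≠ i}, (V k.1).card : ℕ) : ℝ) := by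
        exact_mod_cast h1
    _ = ∏ k : {k : Fin r // k ≠ i}, ((V k.1).card : ℝ) := by push_cast; rfl
    _ ≤ ∏ k : {k : Fin r // k ≠ i}, b :=
        Finset.prod_le_prod (fun _ _ => by positivity) (fun k _ => hb k.1)
    _ = b ^ (r - 1) := by
        rw [Finset.prod_const, card_univ]
        congr 1
        rw [Fintype.card_subtype_compl]
        simp

lemma Trans_hits {r : ℕ} {V : Fin r → Finset (Fin n)} {i k : Fin r} (hk : k ≠ i)
    {T : Finset (Fin n)} (hT : T ∈ Trans V i) : ∃ x ∈ T, x ∈ V k := by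
  rw [Trans, mem_image] at hT
  obtain ⟨g, hg, rfl⟩ := hT
  rw [Fintype.mem_piFinset] at hg
  exact ⟨g ⟨k, hk⟩, by simp, hg ⟨k, hk⟩⟩

/-- Link sets of `u` inside the union of the classes. -/
def good {r : ℕ} (H : Finset (Finset (Fin n))) (V : Fin r → Finset (Fin n)) (u : Fin n) :
    Finset (Finset (Fin n)) :=
  univ.filter (fun T => u ∉ T ∧ insert u T ∈ H ∧ ∀ x ∈ T, ∃ i, x ∈ V i)

lemma mem_good {r : ℕ} {H : Finset (Finset (Fin n))} {V : Fin r → Finset (Fin n)} {u : Fin n}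
    {T : Finset (Fin n)} :
    T ∈ good H V u ↔ u ∉ T ∧ insert u T ∈ H ∧ ∀ x ∈ T, ∃ i, x ∈ V i := by
  simp [good]

lemma good_mem_Trans {r : ℕ} (hr : 2 ≤ r) {H : Finset (Finset (Fin n))} (hH : ∀ e ∈ H, e.card = r)
    {V : Fin r → Finset (Fin n)}
    (hind : ∀ i, ∀ u ∈ V i, ∀ v ∈ V i, u ≠ v → ∀ C ∈ H, u ∈ C → v ∈ C → False)
    {u : Fin n} {T : Finset (Fin n)} (hT : T ∈ good H V u) : ∃ i, T ∈ Trans V i := by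
  classical
  rw [mem_good] at hT
  obtain ⟨huT, hT, hV⟩ := hT
  have hc : T.card = r - 1 := by
    have := hH _ hT
    rw [card_insert_of_notMem huT] at this
    omega
  let c : Fin n → Fin r := fun x => if h : ∃ i, x ∈ V i then h.choose else ⟨0, by omega⟩
  have hcV : ∀ x ∈ T, x ∈ V (c x) := by
    intro x hx
    have h := hV x hx
    simp only [c, dif_pos h]
    exact h.choose_spec
  have hinj : Set.InjOn c T := by
    intro x hx y hy hxy
    by_contra hne
    exact hind (c x) x (hcV x hx) y (hxy ▸ hcV y hy) hne _ hT (mem_insert_of_mem hx)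
      (mem_insert_of_mem hy)
  have hci : (T.image c).card = r - 1 := by rw [card_image_of_injOn hinj, hc]
  have hcompl : ((T.image c)ᶜ).card = 1 := by
    rw [card_compl, hci, Fintype.card_fin]; omega
  rw [card_eq_one] at hcompl
  obtain ⟨i, hi⟩ := hcompl
  have him : ∀ k : {k : Fin r // k ≠ i}, ∃ x ∈ T, c x = k.1 := by
    intro k
    have : k.1 ∉ (T.image c)ᶜ := by rw [hi, mem_singleton]; exact k.2
    simpa using this
  choose g hgT hgc using him
  refine ⟨i, ?_⟩
  rw [Trans, mem_image]
  refine ⟨g, ?_, ?_⟩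
  · rw [Fintype.mem_piFinset]
    intro k
    have := hcV _ (hgT k)
    rwa [hgc] at this
  · apply Finset.Subset.antisymm
    · intro x hx
      rw [mem_image] at hx
      obtain ⟨k, _, rfl⟩ := hx
      exact hgT k
    · intro x hx
      have hne : c x ≠ i := by
        intro h
        have : i ∈ (T.image c)ᶜ := by rw [hi]; simp
        rw [mem_compl] at this
        exact this (h ▸ mem_image_of_mem c hx)
      rw [mem_image]
      refine ⟨⟨c x, hne⟩, mem_univ _, ?_⟩
      exact hinj (hgT _) hx (hgc _)

lemma inter_of_card {X A B : Finset (Finset (Fin n))} (hA : A ⊆ X) (hB : B ⊆ X)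
    (h : (X.card : ℝ) < A.card + B.card) : ∃ T, T ∈ A ∧ T ∈ B := by
  have h' : X.card < A.card + B.card := by exact_mod_cast h
  obtain ⟨T, hT⟩ := Finset.inter_nonempty_of_card_lt_card_add_card hA hB h'
  rw [mem_inter] at hT
  exact ⟨T, hT⟩

lemma structure_lemma {r : ℕ} (hr : 2 ≤ r) {H : Finset (Finset (Fin n))}
    (hH : ∀ e ∈ H, e.card = r) (hT : TriangleFree H)
    (V : Fin r → Finset (Fin n))
    (hind : ∀ i, ∀ u ∈ V i, ∀ v ∈ V i, u ≠ v → ∀ C ∈ H, u ∈ C → v ∈ C → False)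
    (M K : ℝ) (hM0 : 0 ≤ M) (hM : ∀ i, ((Trans V i).card : ℝ) ≤ M)
    (hK : ∀ u, K ≤ (good H V u).card) (hKM : r * M < (r + 1) * K) : RPartite r H := by
  classical
  have hr0 : (2 : ℝ) ≤ r := by exact_mod_cast hr
  have hKM2 : M < 2 * K := by
    have hK0 : 0 < K := by
      by_contra hcon
      nlinarith
    nlinarith
  have hV : ∀ i, ∀ u ∈ V i, good H V u ⊆ Trans V i := by
    intro i u hu T hTg
    obtain ⟨j, hj⟩ := good_mem_Trans hr hH hind hTg
    by_cases hij : i = j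
    · rw [hij]; exact hj
    · exfalso
      obtain ⟨x, hxT, hxV⟩ := Trans_hits hij hj
      rw [mem_good] at hTg
      refine hind i u hu x hxV ?_ _ hTg.2.1 (mem_insert_self _ _) (mem_insert_of_mem hxT)
      rintro rfl
      exact hTg.1 hxT
  have hall : ∀ u, ∃ i, good H V u ⊆ Trans V i := by
    intro u
    have hpig : ∃ i : Fin r, K ≤ r * ((good H V u ∩ Trans V i).card : ℝ) := by
      by_contra! hcon
      have hcov : good H V u ⊆ univ.biUnion (fun i => good H V u ∩ Trans V i) := by
        intro T hTg
        obtain ⟨j, hj⟩ := good_mem_Trans hr hH hind hTg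
        rw [mem_biUnion]
        exact ⟨j, mem_univ _, mem_inter.2 ⟨hTg, hj⟩⟩
      have h1 : (good H V u).card ≤ ∑ i : Fin r, (good H V u ∩ Trans V i).card :=
        (card_le_card hcov).trans card_biUnion_le
      have h2 : ((good H V u).card : ℝ) ≤ ∑ i : Fin r, ((good H V u ∩ Trans V i).card : ℝ) := by
        exact_mod_cast h1
      have hne : (univ : Finset (Fin r)).Nonempty := ⟨⟨0, by omega⟩, mem_univ _⟩
      have h3 := Finset.sum_lt_sum_of_nonempty hne (fun i _ => hcon i)
      rw [← Finset.mul_sum, Finset.sum_const, card_univ, Fintype.card_fin, nsmul_eq_mul] at h3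
      have h4 := lt_of_mul_lt_mul_left h3 (by linarith)
      linarith [hK u]
    obtain ⟨i, hi⟩ := hpig
    refine ⟨i, ?_⟩
    intro T hTg
    obtain ⟨j, hj⟩ := good_mem_Trans hr hH hind hTg
    by_cases hij : i = j
    · rw [hij]; exact hj
    exfalso
    obtain ⟨c, hcT, hcV⟩ := Trans_hits hij hj
    have hlt : ((Trans V i).card : ℝ) < (good H V u ∩ Trans V i).card + (good H V c).card := by
      have h1 := hM i
      have h2 := hK c
      by_contra hcon
      nlinarith
    obtain ⟨S, hS1, hS2⟩ := inter_of_card inter_subset_right (hV i c hcV) hlt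
    rw [mem_inter, mem_good] at hS1
    rw [mem_good] at hS2 hTg
    have huc : u ≠ c := by rintro rfl; exact hTg.1 hcT
    exact no_common_link hH hT huc hS1.1.1 hS1.1.2.1 hS2.2.1 hTg.2.1 (mem_insert_self _ _)
      (mem_insert_of_mem hcT)
  choose P hP using hall
  refine ⟨P, ?_⟩
  intro e he
  have hinj : Set.InjOn P e := by
    intro u hu v hv huv
    by_contra hne
    have hlt : ((Trans V (P u)).card : ℝ) < (good H V u).card + (good H V v).card := by
      linarith [hM (P u), hK u, hK v]
    obtain ⟨S, hS1, hS2⟩ := inter_of_card (hP u) (huv ▸ hP v) hlt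
    rw [mem_good] at hS1 hS2
    exact no_common_link hH hT hne hS1.1 hS1.2.1 hS2.2.1 he hu hv
  have himg : e.image P = univ := by
    apply Finset.eq_univ_of_card
    rw [card_image_of_injOn hinj, hH e he, Fintype.card_fin]
  intro k
  have hk : k ∈ e.image P := by rw [himg]; exact mem_univ _
  rw [mem_image] at hk
  obtain ⟨u, hu, rfl⟩ := hk
  rw [card_eq_one]
  refine ⟨u, ?_⟩
  ext x
  rw [mem_filter, mem_singleton]
  constructor
  · rintro ⟨hx, hxu⟩
    exact hinj hx hu hxu
  · rintro rfl
    exact ⟨hu, rfl⟩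


lemma card_good_ge {r : ℕ} (hr : 2 ≤ r) {H : Finset (Finset (Fin n))}
    (hH : ∀ e ∈ H, e.card = r) (V : Fin r → Finset (Fin n)) (u : Fin n) :
    (H.filter (fun e => u ∈ e)).card ≤
      (good H V u).card + (univ \ univ.biUnion V).card * n ^ (r - 2) := by
  classical
  set R := univ \ univ.biUnion V with hR
  let bad : Finset (Finset (Fin n)) :=
    (R ×ˢ powersetCard (r - 2) (univ : Finset (Fin n))).image (fun p => insert p.1 p.2)
  have hbad : bad.card ≤ R.card * n ^ (r - 2) := by
    refine card_image_le.trans ?_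
    rw [card_product, card_powersetCard, card_univ, Fintype.card_fin]
    exact Nat.mul_le_mul_left _ (Nat.choose_le_pow _ _)
  have hmap : (H.filter (fun e => u ∈ e)).card ≤ (good H V u ∪ bad).card := by
    apply Finset.card_le_card_of_injOn (fun e => e.erase u)
    · intro e he
      rw [mem_coe, mem_filter] at he
      rw [mem_coe, mem_union]
      by_cases hb : ∀ x ∈ e.erase u, ∃ i, x ∈ V i
      · left
        rw [mem_good]
        refine ⟨notMem_erase _ _, ?_, hb⟩
        rw [insert_erase he.2]; exact he.1
      · right
        push Not at hb
        obtain ⟨x, hx, hxV⟩ := hb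
        simp only [bad, mem_image, mem_product, mem_powersetCard]
        refine ⟨(x, (e.erase u).erase x), ⟨?_, subset_univ _, ?_⟩, insert_erase hx⟩
        · simp [hR, hxV]
        · rw [card_erase_of_mem hx, card_erase_of_mem he.2, hH e he.1]
          omega
    · intro e he e' he' h
      rw [mem_coe, mem_filter] at he he'
      simp only at h
      rw [← insert_erase he.2, h, insert_erase he'.2]
  calc _ ≤ _ := hmap
    _ ≤ _ := card_union_le _ _
    _ ≤ _ := by omega

lemma exists_eps (r : ℕ) (hr : 2 ≤ r) : ∃ ε > (0 : ℝ), ε ≤ 1 / (2 * (r : ℝ) ^ (r - 1)) ∧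
    (r : ℝ) * (1 / r + 2 * √(2 * (r : ℝ) ^ r * ε)) ^ (r - 1) <
      (r + 1) * (1 / (r : ℝ) ^ (r - 1) - ε - 2 * √(2 * (r : ℝ) ^ r * ε)) := by
  have hr0 : (0 : ℝ) < r := by positivity
  have hc : ContinuousAt (fun ε : ℝ => (r + 1) * (1 / (r : ℝ) ^ (r - 1) - ε - 2 * √(2 * (r : ℝ) ^ r * ε))
      - (r : ℝ) * (1 / r + 2 * √(2 * (r : ℝ) ^ r * ε)) ^ (r - 1)) 0 := by
    apply Continuous.continuousAt
    fun_prop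
  have h0 : (0 : ℝ) < (fun ε : ℝ => (r + 1) * (1 / (r : ℝ) ^ (r - 1) - ε - 2 * √(2 * (r : ℝ) ^ r * ε))
      - (r : ℝ) * (1 / r + 2 * √(2 * (r : ℝ) ^ r * ε)) ^ (r - 1)) 0 := by
    simp only [mul_zero, Real.sqrt_zero, sub_zero, add_zero, one_div, inv_pow]
    have : 0 < ((r : ℝ) ^ (r - 1))⁻¹ := by positivity
    linarith
  have h1 := hc.eventually (lt_mem_nhds h0)
  have h2 : ∀ᶠ ε : ℝ in nhds 0, ε < 1 / (2 * (r : ℝ) ^ (r - 1)) :=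
    gt_mem_nhds (by positivity)
  have h3 := (h1.and h2).filter_mono (nhdsWithin_le_nhds (s := Set.Ioi (0 : ℝ)))
  obtain ⟨ε, ⟨h4, h5⟩, h6⟩ := (h3.and self_mem_nhdsWithin).exists
  refine ⟨ε, h6, h5.le, ?_⟩
  linarith

end TR

/-- There exist `ε > 0` and `N₀` such that every symmetrized `𝒯_r`-free
`r`-graph `H` on `n ≥ N₀` vertices with `δ(H) ≥ n^{r-1}/r^{r-1} − ε n^{r-1}`
is `r`-partite. -/
theorem symmetrized_min_degree_r_partite :
    ∀ r : ℕ, 2 ≤ r → ∃ ε > (0 : ℝ), ∃ N₀ : ℕ, ∀ n : ℕ, N₀ ≤ n →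
      ∀ H : Finset (Finset (Fin n)), (∀ e ∈ H, e.card = r) →
        TriangleFree H → Symmetrized r n H →
        (∀ v : Fin n, (n : ℝ) ^ (r - 1) / (r : ℝ) ^ (r - 1) - ε * (n : ℝ) ^ (r - 1) ≤
          ((H.filter (fun e => v ∈ e)).card : ℝ)) →
        RPartite r H := by
  intro r hr
  obtain ⟨ε, hε, hε2, hnum⟩ := TR.exists_eps r hr
  refine ⟨ε, hε, 1, ?_⟩
  intro n hn H hH hT _ hdeg
  obtain ⟨f, hf, hlow⟩ := TR.good_edge hr hn hH hT ε hε hε2 hdeg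
  have hn0 : (0 : ℝ) < n := by exact_mod_cast hn
  have hr0 : (0 : ℝ) < r := by positivity
  set s := √(2 * (r : ℝ) ^ r * ε) with hs
  have hs0 : 0 ≤ s := Real.sqrt_nonneg _
  let V : Fin r → Finset (Fin n) := fun i => TR.W H ((univ.erase i).image f)
  have hf' := TR.mem_E.1 hf
  have hWH : ∀ i, ∀ u ∈ V i, u ∉ (univ.erase i).image f ∧
      insert u ((univ.erase i).image f) ∈ H := by
    intro i u hu
    obtain ⟨h1, B, hB, h2⟩ := TR.mem_W.1 hu
    refine ⟨h1, ?_⟩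
    rwa [Finset.eq_of_subset_of_card_le h2 ?_]
    rw [card_insert_of_notMem h1, card_image_of_injective _ hf'.1, hH B hB,
      card_erase_of_mem (mem_univ _), card_univ, Fintype.card_fin]
    omega
  have hind : ∀ i, ∀ u ∈ V i, ∀ v ∈ V i, u ≠ v → ∀ C ∈ H, u ∈ C → v ∈ C → False := by
    intro i u hu v hv huv C hC huC hvC
    exact TR.no_common_link hH hT huv (hWH i u hu).1 (hWH i u hu).2 (hWH i v hv).2 hC huC hvC
  have hdisj : ∀ i j, i ≠ j → Disjoint (V i) (V j) := by
    intro i j hij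
    refine TR.W_disj hH hT f hf _ _ ?_
    ext k
    simp only [mem_union, mem_erase, mem_univ, and_true, iff_true]
    by_contra! h
    exact hij (h.1.symm.trans h.2)
  have hsumV : (∑ i, ((V i).card : ℝ)) + (univ \ univ.biUnion V).card = n := by
    have h1 : (univ.biUnion V).card = ∑ i, (V i).card :=
      card_biUnion (fun i _ j _ hij => hdisj i j hij)
    have h2 := Finset.card_sdiff_add_card_eq_card (Finset.subset_univ (univ.biUnion V))
    rw [card_univ, Fintype.card_fin, h1] at h2
    have h3 : (((univ \ univ.biUnion V).card : ℕ) : ℝ) + ∑ i, ((V i).card : ℝ) = n := by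
      exact_mod_cast h2
    linarith
  have hR : ((univ \ univ.biUnion V).card : ℝ) ≤ 2 * s * n := by
    have h := Finset.card_nsmul_le_sum (univ : Finset (Fin r)) (fun i => ((V i).card : ℝ)) _
      (fun i _ => hlow i)
    rw [card_univ, Fintype.card_fin, nsmul_eq_mul] at h
    have : (r : ℝ) * ((1 - 2 * s) * (n / r)) = (1 - 2 * s) * n := by field_simp
    rw [this] at h
    linarith
  have hup : ∀ i, ((V i).card : ℝ) ≤ (1 / r + 2 * s) * n := by
    intro i
    have h := Finset.card_nsmul_le_sum (univ.erase i : Finset (Fin r)) (fun i => ((V i).card : ℝ)) _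
      (fun i _ => hlow i)
    rw [card_erase_of_mem (mem_univ _), card_univ, Fintype.card_fin, nsmul_eq_mul,
      Nat.cast_sub (by omega), Nat.cast_one] at h
    have h2 := Finset.add_sum_erase univ (fun i => ((V i).card : ℝ)) (mem_univ i)
    have h3 : ((r : ℝ) - 1) * ((1 - 2 * s) * (n / r)) = n - (1 / r + 2 * s) * n + 2 * s * n / r := by
      field_simp
      ring
    have h4 : 0 ≤ 2 * s * n / r := by positivity
    have h5 : (0 : ℝ) ≤ (univ \ univ.biUnion V).card := by positivity
    linarith
  refine TR.structure_lemma hr hH hT V hind (((1 / r + 2 * s) * n) ^ (r - 1))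
    ((1 / (r : ℝ) ^ (r - 1) - ε - 2 * s) * (n : ℝ) ^ (r - 1)) (by positivity)
    (fun i => TR.card_Trans_le V i _ hup) ?_ ?_
  · intro u
    have h1 := TR.card_good_ge hr hH V u
    have h2 : ((H.filter (fun e => u ∈ e)).card : ℝ) ≤
        (TR.good H V u).card + (univ \ univ.biUnion V).card * (n : ℝ) ^ (r - 2) := by
      exact_mod_cast h1
    have h3 := hdeg u
    have h4 : ((univ \ univ.biUnion V).card : ℝ) * (n : ℝ) ^ (r - 2) ≤ 2 * s * (n : ℝ) ^ (r - 1) := by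
      have : (n : ℝ) ^ (r - 1) = n * (n : ℝ) ^ (r - 2) := by
        rw [← pow_succ']; congr 1; omega
      rw [this, ← mul_assoc]
      gcongr
    have h5 : (1 / (r : ℝ) ^ (r - 1) - ε - 2 * s) * (n : ℝ) ^ (r - 1) =
      (n : ℝ) ^ (r - 1) / (r : ℝ) ^ (r - 1) - ε * (n : ℝ) ^ (r - 1) - 2 * s * (n : ℝ) ^ (r - 1) := by
      ring
    rw [h5]
    linarith
  · rw [mul_pow, ← mul_assoc, ← mul_assoc]
    exact mul_lt_mul_of_pos_right hnum (by positivity)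
end
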